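/- Let (t,m) ∈ [0,T] × 𝒫₂ and M ∈ 𝓜(t,m). Then for all t ≤ t₁ ≤ t₂ ≤ t₃ ≤ T, the following Jensen-type inequality holds almost surely: d₁(p^{t₂,M_{t₂}}_{t₃}, M_{t₁}) ≤ E[ d₁(M_{t₃}, M_{t₁}) | 𝓕^M_{t₂} ]. -/

import Mathlib

open MeasureTheory Filter Set
open scoped Topology ENNReal NNReal BoundedContinuousFunction

noncomputable section

/-- Euclidean space `ℝ^d`. -/
abbrev Ed (d : ℕ) : Type := EuclideanSpace ℝ (Fin d)

/-- `m ∈ 𝒫_p` : Borel probability measure on `ℝ^d` with finite `p`-th moment. -/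
def MemP (d : ℕ) (p : ℝ) (m : Measure (Ed d)) : Prop :=
  IsProbabilityMeasure m ∧ Integrable (fun x => ‖x‖ ^ p) m

/-- `γ` is a coupling of `m` and `m'`. -/
def IsCoupling (d : ℕ) (γ : Measure (Ed d × Ed d)) (m m' : Measure (Ed d)) : Prop :=
  γ.map Prod.fst = m ∧ γ.map Prod.snd = m'

/-- The `p`-Wasserstein distance. -/
def wdist (d : ℕ) (p : ℝ) (m m' : Measure (Ed d)) : ℝ :=
  sInf { c : ℝ | ∃ γ : Measure (Ed d × Ed d), IsProbabilityMeasure γ ∧ IsCoupling d γ m m' ∧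
      c = (∫ q, ‖q.1 - q.2‖ ^ p ∂γ) ^ (1 / p) }

/-- The Gaussian kernel `ρ_δ`. -/
def gaussDensity (d : ℕ) (δ : ℝ) (x : Ed d) : ℝ :=
  (2 * Real.pi * δ) ^ (-(d : ℝ) / 2) * Real.exp (-‖x‖ ^ 2 / (2 * δ))

/-- The centered Gaussian measure with variance `δ` on `ℝ^d`. -/
def gaussMeasure (d : ℕ) (δ : ℝ) : Measure (Ed d) :=
  volume.withDensity fun x => ENNReal.ofReal (gaussDensity d δ x)

/-- The heat flow `p^{t,m}_s` : the law at time `s` of a Brownian motion started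
at time `t` with initial law `m`. -/
def heatFlow (d : ℕ) (t s : ℝ) (m : Measure (Ed d)) : Measure (Ed d) :=
  if s ≤ t then m
  else Measure.map (fun q : Ed d × Ed d => q.1 + q.2) (m.prod (gaussMeasure d (s - t)))

/-- The natural filtration of a measure-valued process, made right-continuous:
`𝓕^M_s = ⋂_{u > s} σ(M_r, r ∈ [t,u])`. -/
def genFiltration {Ω : Type} (d : ℕ) (M : ℝ → Ω → Measure (Ed d)) (t s : ℝ) :
    MeasurableSpace Ω :=
  ⨅ u ∈ Set.Ioi s, ⨆ r ∈ Set.Icc t u, MeasurableSpace.comap (M r) inferInstance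

/-- A path `[t,T] → (𝒫₁,d₁)` is càdlàg: right-continuous with left limits (for `d₁`). -/
def CadlagD1 (d : ℕ) (t T : ℝ) (g : ℝ → Measure (Ed d)) : Prop :=
  (∀ s ∈ Set.Ico t T, Tendsto (fun r => wdist d 1 (g r) (g s)) (𝓝[Set.Ici s] s) (𝓝 0)) ∧
  (∀ s ∈ Set.Ioc t T, ∃ μ : Measure (Ed d),
      Tendsto (fun r => wdist d 1 (g r) μ) (𝓝[Set.Ico t s] s) (𝓝 0))

/-- An element of `𝓜(t,m)` : a càdlàg `(𝒫₁,d₁)`-valued process `M = (M_s)_{s∈[t,T]}`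
on some probability space such that (i) `E[M_t(φ)] = m(φ)` for all bounded continuous `φ`
and (ii) `E[M_{t₂}(φ) | 𝓕^M_{t₁}] = p^{t₁,M_{t₁}}_{t₂}(φ)` for all `t ≤ t₁ ≤ t₂ ≤ T` and
all bounded continuous `φ`. -/
structure MVP (d : ℕ) (T t : ℝ) (m : Measure (Ed d)) where
  Ω : Type
  mΩ : MeasurableSpace Ω
  P : @Measure Ω mΩ
  probP : IsProbabilityMeasure P
  M : ℝ → Ω → Measure (Ed d)
  meas : ∀ s, @Measurable Ω (Measure (Ed d)) mΩ inferInstance (M s)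
  inP1 : ∀ s ∈ Set.Icc t T, ∀ ω, MemP d 1 (M s ω)
  cadlag : ∀ ω, CadlagD1 d t T (fun s => M s ω)
  init : ∀ φ : Ed d →ᵇ ℝ, ∫ ω, (∫ x, φ x ∂(M t ω)) ∂P = ∫ x, φ x ∂m
  cond : ∀ t₁ t₂ : ℝ, t ≤ t₁ → t₁ ≤ t₂ → t₂ ≤ T → ∀ φ : Ed d →ᵇ ℝ,
    P[(fun ω => ∫ x, φ x ∂(M t₂ ω)) | genFiltration d M t t₁]
      =ᵐ[P] fun ω => ∫ x, φ x ∂(heatFlow d t₁ t₂ (M t₁ ω))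

/-- **Strong duality for the finite optimal transport problem.** -/
lemma exists_transportPlan_le {ι κ : Type*} [Fintype ι] [Fintype κ] (c : ι → κ → ℝ)
    {a : ι → ℝ} {b : κ → ℝ} (ha : a ∈ stdSimplex ℝ ι) (hb : b ∈ stdSimplex ℝ κ) {W : ℝ}
    (hW : ∀ (f : ι → ℝ) (g : κ → ℝ), (∀ i j, f i + g j ≤ c i j) →
      ∑ i, a i * f i + ∑ j, b j * g j ≤ W) :
    ∃ π : ι → κ → ℝ, (∀ i j, 0 ≤ π i j) ∧ (∀ i, ∑ j, π i j = a i) ∧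
      (∀ j, ∑ i, π i j = b j) ∧ ∑ i, ∑ j, π i j * c i j ≤ W := by
  classical
  let L : (ι × κ → ℝ) →ₗ[ℝ] (ι → ℝ) × (κ → ℝ) × ℝ :=
    { toFun := fun π => (fun i => ∑ j, π (i, j), fun j => ∑ i, π (i, j),
        ∑ i, ∑ j, π (i, j) * c i j)
      map_add' := fun π π' => by
        ext <;> simp [Finset.sum_add_distrib, add_mul]
      map_smul' := fun r π => by
        ext <;> simp [Finset.mul_sum, mul_assoc] }
  let D : Set ((ι → ℝ) × (κ → ℝ) × ℝ) := {a} ×ˢ {b} ×ˢ Iic W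
  by_cases hdisj : Disjoint (L '' stdSimplex ℝ (ι × κ)) D
  · exfalso
    obtain ⟨F, u, v, hu, huv, hv⟩ := geometric_hahn_banach_compact_closed
      ((convex_stdSimplex ℝ (ι × κ)).linear_image L)
      ((isCompact_stdSimplex ℝ (ι × κ)).image L.continuous_of_finiteDimensional)
      ((convex_singleton a).prod ((convex_singleton b).prod (convex_Iic W)))
      (isClosed_singleton.prod (isClosed_singleton.prod isClosed_Iic)) hdisj
    let f : ι → ℝ := fun i => F (Pi.single i 1, 0, 0)
    let g : κ → ℝ := fun j => F (0, Pi.single j 1, 0)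
    let l : ℝ := F (0, 0, 1)
    have hF : ∀ x y s, F (x, y, s) = ∑ i, x i * f i + ∑ j, y j * g j + s * l := by
      intro x y s
      have hx : ∑ i, x i • (Pi.single i 1 : ι → ℝ) = x := by
        ext i; simp [Finset.sum_apply, Pi.single_apply]
      have hy : ∑ i, y i • (Pi.single i 1 : κ → ℝ) = y := by
        ext i; simp [Finset.sum_apply, Pi.single_apply]
      have h1 : F (x, 0, 0) = ∑ i, x i * f i := by
        have := map_sum (F.comp (ContinuousLinearMap.inl ℝ (ι → ℝ) ((κ → ℝ) × ℝ)))
          (fun i => x i • (Pi.single i 1 : ι → ℝ)) Finset.univ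
        rw [hx] at this
        simp only [map_smul, smul_eq_mul] at this
        exact this
      have h2 : F (0, y, 0) = ∑ i, y i * g i := by
        have := map_sum ((F.comp (ContinuousLinearMap.inr ℝ (ι → ℝ) ((κ → ℝ) × ℝ))).comp
          (ContinuousLinearMap.inl ℝ (κ → ℝ) ℝ))
          (fun i => y i • (Pi.single i 1 : κ → ℝ)) Finset.univ
        rw [hy] at this
        simp only [map_smul, smul_eq_mul] at this
        exact this
      have h3 : F (0, 0, s) = s * l := by
        have := F.map_smul s ((0, 0, 1) : (ι → ℝ) × (κ → ℝ) × ℝ)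
        simpa using this
      rw [← h1, ← h2, ← h3, ← map_add, ← map_add]
      simp
    have hK : ∀ i j, f i + g j + c i j * l < u := by
      intro i j
      have := hu _ (mem_image_of_mem L (single_mem_stdSimplex ℝ (i, j)))
      have hL : L (Pi.single (i, j) 1) = (Pi.single i 1, Pi.single j 1, c i j) := by
        ext k
        · simp [L, Pi.single_apply, Prod.ext_iff, ite_and, eq_comm]
        · simp [L, Pi.single_apply, Prod.ext_iff, ite_and, eq_comm]
        · simp [L, Pi.single_apply, Prod.ext_iff, ite_and]
      rw [hL, hF] at this
      simpa [Pi.single_apply] using this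
    have hD : ∀ s ≤ W, v < ∑ i, a i * f i + ∑ j, b j * g j + s * l := by
      intro s hs
      rw [← hF]
      exact hv _ ⟨rfl, rfl, hs⟩
    set A := ∑ i, a i * f i + ∑ j, b j * g j with hA
    have hl : l ≤ 0 := by
      by_contra! hl
      have := hD (min W ((v - A) / l)) (min_le_left _ _)
      have h2 : min W ((v - A) / l) * l ≤ (v - A) / l * l :=
        mul_le_mul_of_nonneg_right (min_le_right _ _) hl.le
      rw [div_mul_cancel₀ _ hl.ne'] at h2
      linarith
    have hDW := hD W le_rfl
    rcases hl.lt_or_eq with hl | hl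
    · have key := hW (fun i => (f i - u) / (-l)) (fun j => g j / (-l)) (fun i j => by
        rw [← add_div, div_le_iff₀ (by linarith)]
        linarith [hK i j])
      have e1 : ∑ i, a i * ((f i - u) / (-l)) = (∑ i, a i * f i - u) / (-l) := by
        have : ∑ i, a i * f i - u = ∑ i, a i * (f i - u) := by
          simp only [mul_sub, Finset.sum_sub_distrib, ← Finset.sum_mul, ha.2, one_mul]
        rw [this, Finset.sum_div]
        exact Finset.sum_congr rfl fun i _ => by ring
      have e2 : ∑ j, b j * (g j / (-l)) = (∑ j, b j * g j) / (-l) := by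
        rw [Finset.sum_div]
        exact Finset.sum_congr rfl fun i _ => by ring
      rw [e1, e2, ← add_div, div_le_iff₀ (by linarith)] at key
      linarith
    · have key : ∑ i, ∑ j, a i * b j * (f i + g j) ≤ ∑ i, ∑ j, a i * b j * u :=
        Finset.sum_le_sum fun i _ => Finset.sum_le_sum fun j _ =>
          mul_le_mul_of_nonneg_left (by have := hK i j; rw [hl] at this; linarith)
            (mul_nonneg (ha.1 i) (hb.1 j))
      have e1 : ∑ i, ∑ j, a i * b j * u = u := by
        simp only [← Finset.sum_mul, ← Finset.mul_sum, ha.2, hb.2, one_mul]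
      have e2 : ∑ i, ∑ j, a i * b j * (f i + g j) = A := by
        have h1 : ∑ i, ∑ j, a i * b j * f i = ∑ i, a i * f i := by
          refine Finset.sum_congr rfl fun i _ => ?_
          rw [← Finset.sum_mul, ← Finset.mul_sum, hb.2, mul_one]
        have h2 : ∑ i, ∑ j, a i * b j * g j = ∑ j, b j * g j := by
          simp only [mul_assoc, ← Finset.mul_sum, ← Finset.sum_mul, ha.2, one_mul]
        simp only [mul_add, Finset.sum_add_distrib, h1, h2, hA]
      rw [hl] at hDW
      linarith
  · obtain ⟨_, ⟨π, hπ, rfl⟩, h1, h2, h3⟩ := not_disjoint_iff.1 hdisj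
    exact ⟨fun i j => π (i, j), fun i j => hπ.1 _, fun i => congrFun h1 i,
      fun j => congrFun h2 j, h3⟩

lemma MemP.integrable_norm {d : ℕ} {μ : Measure (Ed d)} (h : MemP d 1 μ) :
    Integrable (fun x => ‖x‖) μ := by
  simpa using h.2

lemma wdist_one (d : ℕ) (μ ν : Measure (Ed d)) :
    wdist d 1 μ ν = sInf {c : ℝ | ∃ γ : Measure (Ed d × Ed d), IsProbabilityMeasure γ ∧
      IsCoupling d γ μ ν ∧ c = ∫ q, ‖q.1 - q.2‖ ∂γ} := by
  simp [wdist]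

lemma IsCoupling.integral_fst {d : ℕ} {γ : Measure (Ed d × Ed d)} {μ ν : Measure (Ed d)}
    (hγ : IsCoupling d γ μ ν) {f : Ed d → ℝ} (hf : Measurable f) :
    ∫ q, f q.1 ∂γ = ∫ x, f x ∂μ := by
  rw [← hγ.1, integral_map measurable_fst.aemeasurable hf.aestronglyMeasurable]

lemma IsCoupling.integral_snd {d : ℕ} {γ : Measure (Ed d × Ed d)} {μ ν : Measure (Ed d)}
    (hγ : IsCoupling d γ μ ν) {f : Ed d → ℝ} (hf : Measurable f) :
    ∫ q, f q.2 ∂γ = ∫ x, f x ∂ν := by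
  rw [← hγ.2, integral_map measurable_snd.aemeasurable hf.aestronglyMeasurable]

lemma IsCoupling.integrable_fst {d : ℕ} {γ : Measure (Ed d × Ed d)} {μ ν : Measure (Ed d)}
    (hγ : IsCoupling d γ μ ν) {f : Ed d → ℝ} (hf : Integrable f μ) :
    Integrable (fun q => f q.1) γ := by
  have := hγ.1 ▸ hf
  exact this.comp_measurable measurable_fst

lemma IsCoupling.integrable_snd {d : ℕ} {γ : Measure (Ed d × Ed d)} {μ ν : Measure (Ed d)}
    (hγ : IsCoupling d γ μ ν) {f : Ed d → ℝ} (hf : Integrable f ν) :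
    Integrable (fun q => f q.2) γ := by
  have := hγ.2 ▸ hf
  exact this.comp_measurable measurable_snd

lemma IsCoupling.integrable_norm_sub {d : ℕ} {γ : Measure (Ed d × Ed d)} {μ ν : Measure (Ed d)}
    (hγ : IsCoupling d γ μ ν) (hμ : MemP d 1 μ) (hν : MemP d 1 ν) :
    Integrable (fun q : Ed d × Ed d => ‖q.1 - q.2‖) γ := by
  refine ((hγ.integrable_fst hμ.integrable_norm).add
    (hγ.integrable_snd hν.integrable_norm)).mono' (by fun_prop) (ae_of_all _ fun q => ?_)
  simpa using norm_sub_le q.1 q.2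

lemma isCoupling_prod {d : ℕ} (μ ν : Measure (Ed d)) [IsProbabilityMeasure μ]
    [IsProbabilityMeasure ν] : IsCoupling d (μ.prod ν) μ ν :=
  ⟨by simp [Measure.map_fst_prod], by simp [Measure.map_snd_prod]⟩

lemma bddBelow_transportCosts {d : ℕ} (μ ν : Measure (Ed d)) :
    BddBelow {c : ℝ | ∃ γ : Measure (Ed d × Ed d), IsProbabilityMeasure γ ∧
      IsCoupling d γ μ ν ∧ c = ∫ q, ‖q.1 - q.2‖ ∂γ} := by
  refine ⟨0, ?_⟩
  rintro c ⟨γ, -, -, rfl⟩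
  exact integral_nonneg fun q => norm_nonneg _

lemma wdist_le_of_isCoupling {d : ℕ} {μ ν : Measure (Ed d)} {γ : Measure (Ed d × Ed d)}
    [IsProbabilityMeasure γ] (hγ : IsCoupling d γ μ ν) :
    wdist d 1 μ ν ≤ ∫ q, ‖q.1 - q.2‖ ∂γ := by
  rw [wdist_one]
  exact csInf_le (bddBelow_transportCosts μ ν) ⟨γ, ‹_›, hγ, rfl⟩

lemma wdist_one_nonneg {d : ℕ} (μ ν : Measure (Ed d)) : 0 ≤ wdist d 1 μ ν := by
  rw [wdist_one]
  refine Real.sInf_nonneg ?_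
  rintro c ⟨γ, -, -, rfl⟩
  exact integral_nonneg fun q => norm_nonneg _

lemma wdist_le_integral_norm_add {d : ℕ} {μ ν : Measure (Ed d)} (hμ : MemP d 1 μ)
    (hν : MemP d 1 ν) : wdist d 1 μ ν ≤ ∫ x, ‖x‖ ∂μ + ∫ x, ‖x‖ ∂ν := by
  have := hμ.1
  have := hν.1
  have hγ := isCoupling_prod μ ν
  refine (wdist_le_of_isCoupling hγ).trans ?_
  rw [← hγ.integral_fst measurable_norm, ← hγ.integral_snd measurable_norm,
    ← integral_add (hγ.integrable_fst hμ.integrable_norm) (hγ.integrable_snd hν.integrable_norm)]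
  exact integral_mono (hγ.integrable_norm_sub hμ hν)
    ((hγ.integrable_fst hμ.integrable_norm).add (hγ.integrable_snd hν.integrable_norm))
    fun q => norm_sub_le q.1 q.2

lemma LipschitzWith.integrable_of_memP {d : ℕ} {μ : Measure (Ed d)} (hμ : MemP d 1 μ)
    {φ : Ed d → ℝ} (hφ : LipschitzWith 1 φ) : Integrable φ μ := by
  have := hμ.1
  refine ((integrable_const ‖φ 0‖).add hμ.integrable_norm).mono'
    hφ.continuous.aestronglyMeasurable (ae_of_all _ fun x => ?_)
  have h := hφ.dist_le_mul x 0
  have h2 := norm_le_norm_add_norm_sub' (φ x) (φ 0)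
  simp [dist_eq_norm] at h h2 ⊢
  linarith

/-- The easy half of the Kantorovich–Rubinstein duality. -/
lemma integral_sub_integral_le_wdist {d : ℕ} {μ ν : Measure (Ed d)} (hμ : MemP d 1 μ)
    (hν : MemP d 1 ν) {φ : Ed d → ℝ} (hφ : LipschitzWith 1 φ) :
    ∫ x, φ x ∂μ - ∫ x, φ x ∂ν ≤ wdist d 1 μ ν := by
  have := hμ.1
  have := hν.1
  rw [wdist_one]
  refine le_csInf ⟨_, μ.prod ν, inferInstance, isCoupling_prod μ ν, rfl⟩ ?_
  rintro c ⟨γ, -, hγ, rfl⟩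
  have i1 := hγ.integrable_fst (hφ.integrable_of_memP hμ)
  have i2 := hγ.integrable_snd (hφ.integrable_of_memP hν)
  rw [← hγ.integral_fst hφ.continuous.measurable, ← hγ.integral_snd hφ.continuous.measurable,
    ← integral_sub i1 i2]
  refine integral_mono (i1.sub i2) (hγ.integrable_norm_sub hμ hν) fun q => ?_
  have h := hφ.dist_le_mul q.1 q.2
  rw [dist_eq_norm, dist_eq_norm] at h
  simpa using (le_abs_self _).trans h

/-- Glue a transport plan between the discretisations of `μ` and `ν` into a coupling of
`μ` and `ν`. -/
lemma exists_isCoupling_of_transportPlan {d : ℕ} {ι : Type*} [Fintype ι] [MeasurableSpace ι]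
    [MeasurableSingletonClass ι] {μ ν : Measure (Ed d)} (hμ : MemP d 1 μ) (hν : MemP d 1 ν)
    {s : Ed d → ι} (hs : Measurable s) (e : ι → Ed d) {π : ι → ι → ℝ} (hπ : ∀ i j, 0 ≤ π i j)
    (hπ₁ : ∀ i, ∑ j, π i j = μ.real (s ⁻¹' {i})) (hπ₂ : ∀ j, ∑ i, π i j = ν.real (s ⁻¹' {j})) :
    ∃ γ : Measure (Ed d × Ed d), IsProbabilityMeasure γ ∧ IsCoupling d γ μ ν ∧
      ∫ q, ‖e (s q.1) - e (s q.2)‖ ∂γ = ∑ i, ∑ j, π i j * ‖e i - e j‖ := by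
  classical
  have := hμ.1
  have := hν.1
  have hms : ∀ i, MeasurableSet (s ⁻¹' {i}) := fun i => hs (measurableSet_singleton i)
  set a : ι → ℝ := fun i => μ.real (s ⁻¹' {i}) with ha
  set b : ι → ℝ := fun i => ν.real (s ⁻¹' {i}) with hb
  have hπa : ∀ i, a i = 0 → ∀ j, π i j = 0 := fun i hi j =>
    (Finset.sum_eq_zero_iff_of_nonneg fun j _ => hπ i j).1 ((hπ₁ i).trans hi) j (Finset.mem_univ _)
  have hπb : ∀ j, b j = 0 → ∀ i, π i j = 0 := fun j hj i =>
    (Finset.sum_eq_zero_iff_of_nonneg fun i _ => hπ i j).1 ((hπ₂ j).trans hj) i (Finset.mem_univ _)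
  have hsplit : ∀ (η : Measure (Ed d)), ∑ i, η.restrict (s ⁻¹' {i}) = η := by
    intro η
    rw [← Measure.sum_fintype, ← Measure.restrict_iUnion _ hms]
    · rw [show ⋃ i, s ⁻¹' {i} = univ by ext x; simp, Measure.restrict_univ]
    · intro i j hij
      exact Disjoint.preimage _ (by simpa using hij)
  let w : ι → ι → ℝ≥0∞ := fun i j => ENNReal.ofReal (π i j / (a i * b j))
  let γ : Measure (Ed d × Ed d) := ∑ i, ∑ j,
    w i j • (μ.restrict (s ⁻¹' {i})).prod (ν.restrict (s ⁻¹' {j}))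
  have hw₁ : ∀ i j, w i j * ν (s ⁻¹' {j}) = ENNReal.ofReal (π i j / a i) := by
    intro i j
    rw [← ofReal_measureReal, ← ENNReal.ofReal_mul (by have := hπ i j; positivity)]
    congr 1
    change π i j / (a i * b j) * b j = _
    by_cases h : b j = 0
    · simp [hπb j h i]
    · field_simp
  have hw₂ : ∀ i j, w i j * μ (s ⁻¹' {i}) = ENNReal.ofReal (π i j / b j) := by
    intro i j
    rw [← ofReal_measureReal, ← ENNReal.ofReal_mul (by have := hπ i j; positivity)]
    congr 1
    change π i j / (a i * b j) * a i = _
    by_cases h : a i = 0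
    · simp [hπa i h j]
    · field_simp
  have hγ : IsCoupling d γ μ ν := by
    constructor
    · rw [Measure.map_finset_sum measurable_fst.aemeasurable]
      conv_rhs => rw [← hsplit μ]
      refine Finset.sum_congr rfl fun i _ => ?_
      rw [Measure.map_finset_sum measurable_fst.aemeasurable]
      simp only [Measure.map_smul, Measure.map_fst_prod, Measure.restrict_apply_univ, smul_smul,
        hw₁]
      rw [← Finset.sum_smul, ← ENNReal.ofReal_sum_of_nonneg
        (fun j _ => div_nonneg (hπ i j) measureReal_nonneg), ← Finset.sum_div, hπ₁]
      by_cases h : a i = 0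
      · have : μ.restrict (s ⁻¹' {i}) = 0 := by
          rw [Measure.restrict_eq_zero]
          exact (measureReal_eq_zero_iff).1 h
        simp [this]
      · rw [div_self h]; simp
    · rw [Measure.map_finset_sum measurable_snd.aemeasurable]
      conv_rhs => rw [← hsplit ν]
      simp only [Measure.map_finset_sum measurable_snd.aemeasurable]
      rw [Finset.sum_comm]
      refine Finset.sum_congr rfl fun j _ => ?_
      simp only [Measure.map_smul, Measure.map_snd_prod, Measure.restrict_apply_univ, smul_smul,
        hw₂]
      rw [← Finset.sum_smul, ← ENNReal.ofReal_sum_of_nonneg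
        (fun i _ => div_nonneg (hπ i j) measureReal_nonneg), ← Finset.sum_div, hπ₂]
      by_cases h : b j = 0
      · have : ν.restrict (s ⁻¹' {j}) = 0 := by
          rw [Measure.restrict_eq_zero]
          exact (measureReal_eq_zero_iff).1 h
        simp [this]
      · rw [div_self h]; simp
  have hprob : IsProbabilityMeasure γ := by
    refine ⟨?_⟩
    have : γ.map Prod.fst univ = 1 := by rw [hγ.1]; simp
    rwa [Measure.map_apply measurable_fst MeasurableSet.univ, preimage_univ] at this
  refine ⟨γ, hprob, hγ, ?_⟩
  have hpiece : ∀ i j, ∀ᵐ q ∂((μ.restrict (s ⁻¹' {i})).prod (ν.restrict (s ⁻¹' {j}))),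
      ‖e (s q.1) - e (s q.2)‖ = ‖e i - e j‖ := by
    intro i j
    rw [Measure.prod_restrict]
    filter_upwards [ae_restrict_mem ((hms i).prod (hms j))] with q hq
    have h1 : s q.1 = i := hq.1
    have h2 : s q.2 = j := hq.2
    rw [h1, h2]
  have hint : ∀ i j, Integrable (fun q : Ed d × Ed d => ‖e (s q.1) - e (s q.2)‖)
      (w i j • (μ.restrict (s ⁻¹' {i})).prod (ν.restrict (s ⁻¹' {j}))) := fun i j =>
    ((integrable_congr (hpiece i j)).2 (integrable_const _)).smul_measure ENNReal.ofReal_ne_top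
  rw [integral_finsetSum_measure fun i _ => integrable_finsetSum_measure.2 fun j _ => hint i j]
  refine Finset.sum_congr rfl fun i _ => ?_
  rw [integral_finsetSum_measure fun j _ => hint i j]
  refine Finset.sum_congr rfl fun j _ => ?_
  rw [integral_smul_measure, integral_congr_ae (hpiece i j), integral_const, measureReal_def,
    ← univ_prod_univ, Measure.prod_prod, Measure.restrict_apply_univ, Measure.restrict_apply_univ,
    ENNReal.toReal_mul, ENNReal.toReal_ofReal (by have := hπ i j; positivity), smul_eq_mul,
    smul_eq_mul, ← mul_assoc]
  congr 1
  change π i j / (a i * b j) * (a i * b j) = _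
  by_cases h : a i = 0
  · simp [hπa i h j]
  by_cases h' : b j = 0
  · simp [hπb j h' i]
  field_simp

/-- The `1`-Lipschitz function `x ↦ min_{j ≤ N} (‖x - e j‖ - r j)`, where `e` is a dense
sequence. -/
def coneInf (d N : ℕ) (r : Fin (N + 1) → ℝ) (x : Ed d) : ℝ :=
  Finset.univ.inf' ⟨0, Finset.mem_univ _⟩
    fun j : Fin (N + 1) => ‖x - TopologicalSpace.denseSeq (Ed d) j‖ - r j

lemma coneInf_le {d N : ℕ} (r : Fin (N + 1) → ℝ) (x : Ed d) (j : Fin (N + 1)) :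
    coneInf d N r x ≤ ‖x - TopologicalSpace.denseSeq (Ed d) j‖ - r j :=
  Finset.inf'_le _ (Finset.mem_univ j)

lemma lipschitzWith_coneInf (d N : ℕ) (r : Fin (N + 1) → ℝ) :
    LipschitzWith 1 (coneInf d N r) := by
  refine LipschitzWith.of_le_add fun x y => ?_
  obtain ⟨j, -, hj⟩ := Finset.exists_mem_eq_inf' ⟨0, Finset.mem_univ _⟩
    fun j : Fin (N + 1) => ‖y - TopologicalSpace.denseSeq (Ed d) j‖ - r j
  have h1 := coneInf_le r x j
  have h2 : coneInf d N r y = ‖y - TopologicalSpace.denseSeq (Ed d) j‖ - r j := hj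
  have h3 := norm_sub_le_norm_sub_add_norm_sub x y (TopologicalSpace.denseSeq (Ed d) j)
  rw [dist_eq_norm]
  linarith

/-- Truncation of a real number to `[-n, n]`. -/
def clamp (n : ℕ) (x : ℝ) : ℝ := max (-n) (min n x)

lemma abs_clamp_le (n : ℕ) (x : ℝ) : |clamp n x| ≤ n := by
  have : (0 : ℝ) ≤ n := n.cast_nonneg
  rw [abs_le, clamp]
  exact ⟨le_max_left _ _, max_le (by linarith) (min_le_left _ _)⟩

lemma abs_clamp_le_abs (n : ℕ) (x : ℝ) : |clamp n x| ≤ |x| := by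
  have : (0 : ℝ) ≤ n := n.cast_nonneg
  rw [abs_le, clamp]
  refine ⟨le_max_of_le_right (le_min (by linarith [abs_nonneg x]) (neg_abs_le x)),
    max_le (by linarith [abs_nonneg x]) ((min_le_right _ _).trans (le_abs_self x))⟩

lemma lipschitzWith_clamp (n : ℕ) : LipschitzWith 1 (clamp n) :=
  (LipschitzWith.id.const_min (n : ℝ)).const_max (-n : ℝ)

lemma tendsto_clamp (x : ℝ) : Tendsto (fun n => clamp n x) atTop (𝓝 x) := by
  obtain ⟨n₀, hn₀⟩ := exists_nat_ge |x|
  refine tendsto_const_nhds.congr' ?_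
  filter_upwards [eventually_ge_atTop n₀] with n hn
  have h : |x| ≤ n := hn₀.trans (by exact_mod_cast hn)
  rw [clamp, min_eq_right ((le_abs_self x).trans h), max_eq_right (by linarith [neg_abs_le x])]

lemma tendsto_integral_clamp {α : Type*} [MeasurableSpace α] {μ : Measure α} {φ : α → ℝ}
    (hφ : Integrable φ μ) :
    Tendsto (fun n => ∫ x, clamp n (φ x) ∂μ) atTop (𝓝 (∫ x, φ x ∂μ)) :=
  tendsto_integral_of_dominated_convergence (fun x => |φ x|)
    (fun n => (lipschitzWith_clamp n).continuous.comp_aestronglyMeasurable hφ.1) hφ.abs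
    (fun n => ae_of_all _ fun x => abs_clamp_le_abs n (φ x))
    (ae_of_all _ fun x => tendsto_clamp (φ x))

/-- A countable family of bounded `1`-Lipschitz functions which determines `d₁`. -/
def testFun (d : ℕ) (k : (N : ℕ) × (Fin (N + 1) → ℚ) × ℕ) : Ed d →ᵇ ℝ :=
  BoundedContinuousFunction.ofNormedAddCommGroup
    (fun x => clamp k.2.2 (coneInf d k.1 (fun j => k.2.1 j) x))
    ((lipschitzWith_clamp _).continuous.comp (lipschitzWith_coneInf d _ _).continuous) k.2.2
    fun _ => abs_clamp_le _ _

lemma lipschitzWith_testFun (d : ℕ) (k : (N : ℕ) × (Fin (N + 1) → ℚ) × ℕ) :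
    LipschitzWith 1 (testFun d k) := by
  have := (lipschitzWith_clamp k.2.2).comp (lipschitzWith_coneInf d k.1 fun j => k.2.1 j)
  rwa [one_mul] at this

lemma tendsto_integral_norm_sub_nearestPt {d : ℕ} {μ : Measure (Ed d)} (hμ : MemP d 1 μ) :
    Tendsto (fun N => ∫ x, ‖x - SimpleFunc.nearestPt (TopologicalSpace.denseSeq (Ed d)) N x‖ ∂μ)
      atTop (𝓝 0) := by
  have := hμ.1
  set e := TopologicalSpace.denseSeq (Ed d)
  rw [← integral_zero (Ed d) ℝ (μ := μ)]
  refine tendsto_integral_of_dominated_convergence (fun x => ‖x‖ + ‖e 0‖)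
    (fun N => ?_) (hμ.integrable_norm.add (integrable_const _))
    (fun N => ae_of_all _ fun x => ?_) (ae_of_all _ fun x => ?_)
  · exact (measurable_id.sub (SimpleFunc.nearestPt e N).measurable).norm.aestronglyMeasurable
  · have h := SimpleFunc.edist_nearestPt_le e x (Nat.zero_le N)
    rw [edist_dist, edist_dist, ENNReal.ofReal_le_ofReal_iff dist_nonneg, dist_eq_norm,
      dist_eq_norm, norm_sub_rev] at h
    rw [norm_norm]
    linarith [norm_sub_le (e 0) x]
  · have h := SimpleFunc.tendsto_nearestPt (e := e) (x := x)
      (by rw [(TopologicalSpace.denseRange_denseSeq (Ed d)).closure_range]; trivial)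
    simpa using (tendsto_const_nhds.sub h).norm (a := x - x)

lemma LipschitzWith.integral_comp_nearestPt_sub_le {d : ℕ} {μ : Measure (Ed d)} (hμ : MemP d 1 μ)
    {φ : Ed d → ℝ} (hφ : LipschitzWith 1 φ) (s : SimpleFunc (Ed d) (Ed d)) :
    |∫ x, φ (s x) ∂μ - ∫ x, φ x ∂μ| ≤ ∫ x, ‖x - s x‖ ∂μ := by
  have := hμ.1
  have hs : Integrable s μ := s.integrable_of_isFiniteMeasure
  have hid : Integrable (fun x : Ed d => x) μ :=
    (integrable_norm_iff measurable_id.aestronglyMeasurable).1 hμ.integrable_norm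
  have hφs : Integrable (fun x => φ (s x)) μ := (s.map φ).integrable_of_isFiniteMeasure
  rw [← integral_sub hφs (hφ.integrable_of_memP hμ)]
  refine (abs_integral_le_integral_abs).trans (integral_mono
    (hφs.sub (hφ.integrable_of_memP hμ)).abs (hid.sub hs).norm fun x => ?_)
  have h := hφ.dist_le_mul (s x) x
  rw [dist_eq_norm, dist_eq_norm, norm_sub_rev (s x)] at h
  simpa using h

/-- The hard half of the Kantorovich–Rubinstein duality. -/
lemma wdist_le_of_forall_testFun {d : ℕ} {μ ν : Measure (Ed d)} (hμ : MemP d 1 μ)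
    (hν : MemP d 1 ν) {w : ℝ}
    (hw : ∀ k, ∫ x, testFun d k x ∂μ - ∫ x, testFun d k x ∂ν ≤ w) : wdist d 1 μ ν ≤ w := by
  have := hμ.1
  have := hν.1
  set e := TopologicalSpace.denseSeq (Ed d) with he
  have hcone : ∀ N (r : Fin (N + 1) → ℚ), ∫ x, coneInf d N (fun j => r j) x ∂μ
      - ∫ x, coneInf d N (fun j => r j) x ∂ν ≤ w := by
    intro N r
    have hL := lipschitzWith_coneInf d N fun j => r j
    exact le_of_tendsto' ((tendsto_integral_clamp (hL.integrable_of_memP hμ)).sub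
      (tendsto_integral_clamp (hL.integrable_of_memP hν))) fun n => hw ⟨N, r, n⟩
  refine le_of_forall_pos_le_add fun ε hε => ?_
  obtain ⟨N, hNμ, hNν⟩ := (((tendsto_integral_norm_sub_nearestPt hμ).eventually
    (gt_mem_nhds (show 0 < ε / 5 by positivity))).and
    ((tendsto_integral_norm_sub_nearestPt hν).eventually
    (gt_mem_nhds (show 0 < ε / 5 by positivity)))).exists
  let s : Ed d → Fin (N + 1) := fun x =>
    ⟨SimpleFunc.nearestPtInd e N x, Nat.lt_succ_of_le (SimpleFunc.nearestPtInd_le e N x)⟩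
  have hs : Measurable s := by
    refine measurable_to_countable' fun j => ?_
    convert (SimpleFunc.nearestPtInd e N).measurableSet_fiber (j : ℕ) using 1
    ext x
    simp [s, Fin.ext_iff]
  have hes : ∀ x, e (s x) = SimpleFunc.nearestPt e N x := fun x => rfl
  have hdisc : ∀ (η : Measure (Ed d)) [IsProbabilityMeasure η] (f : Fin (N + 1) → ℝ),
      ∫ x, f (s x) ∂η = ∑ i, η.real (s ⁻¹' {i}) * f i := by
    intro η _ f
    have := Measure.isProbabilityMeasure_map (μ := η) hs.aemeasurable
    rw [← integral_map (f := f) hs.aemeasurable (Measurable.of_discrete).aestronglyMeasurable,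
      integral_fintype (Integrable.of_finite)]
    refine Finset.sum_congr rfl fun i _ => ?_
    rw [map_measureReal_apply hs (measurableSet_singleton i), smul_eq_mul]
  have hsimp : ∀ (η : Measure (Ed d)) [IsProbabilityMeasure η],
      (fun i => η.real (s ⁻¹' {i})) ∈ stdSimplex ℝ (Fin (N + 1)) := by
    intro η _
    refine ⟨fun i => measureReal_nonneg, ?_⟩
    have := hdisc η fun _ => 1
    simpa using this.symm
  obtain ⟨π, hπ, hπ₁, hπ₂, hπc⟩ := exists_transportPlan_le
    (fun i j : Fin (N + 1) => ‖e i - e j‖) (hsimp μ) (hsimp ν) (W := w + 3 * (ε / 5)) (by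
      intro f g hfg
      choose r hr₁ hr₂ using fun j => exists_rat_btwn (show g j - ε / 5 < g j by linarith)
      have hL := lipschitzWith_coneInf d N fun j => r j
      have h1 : ∑ i, μ.real (s ⁻¹' {i}) * f i
          ≤ ∑ i, μ.real (s ⁻¹' {i}) * coneInf d N (fun j => r j) (e i) := by
        refine Finset.sum_le_sum fun i _ => mul_le_mul_of_nonneg_left ?_ measureReal_nonneg
        refine Finset.le_inf' _ _ fun j _ => ?_
        linarith [hfg i j, hr₂ j]
      have h2 : ∑ j, ν.real (s ⁻¹' {j}) * g j ≤ ∑ j, ν.real (s ⁻¹' {j}) *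
          (ε / 5 - coneInf d N (fun j => r j) (e j)) := by
        refine Finset.sum_le_sum fun j _ => mul_le_mul_of_nonneg_left ?_ measureReal_nonneg
        have := coneInf_le (fun j => (r j : ℝ)) (e j) j
        rw [← he, sub_self, norm_zero] at this
        linarith [hr₁ j]
      have h3 : ∑ j, ν.real (s ⁻¹' {j}) * (ε / 5 - coneInf d N (fun j => r j) (e j))
          = ε / 5 - ∑ j, ν.real (s ⁻¹' {j}) * coneInf d N (fun j => r j) (e j) := by
        simp only [mul_sub, Finset.sum_sub_distrib, ← Finset.sum_mul, (hsimp ν).2, one_mul]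
      rw [h3, ← hdisc ν fun j => coneInf d N (fun j => r j) (e j)] at h2
      rw [← hdisc μ fun j => coneInf d N (fun j => r j) (e j)] at h1
      have h4 := abs_le.1 (hL.integral_comp_nearestPt_sub_le hμ (SimpleFunc.nearestPt e N))
      have h5 := abs_le.1 (hL.integral_comp_nearestPt_sub_le hν (SimpleFunc.nearestPt e N))
      simp only [hes] at h1 h2
      linarith [hcone N r, h4.2, h5.1])
  obtain ⟨γ, hγp, hγ, hγc⟩ := exists_isCoupling_of_transportPlan hμ hν hs (fun i => e i) hπ hπ₁ hπ₂
  refine (wdist_le_of_isCoupling hγ).trans ?_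
  have hint : ∀ {η : Measure (Ed d)}, MemP d 1 η → Integrable (fun x => ‖x - e (s x)‖) η := by
    intro η hη
    have := hη.1
    exact (((integrable_norm_iff measurable_id.aestronglyMeasurable).1 hη.integrable_norm).sub
      (SimpleFunc.nearestPt e N).integrable_of_isFiniteMeasure).norm
  have hmeas : Measurable fun x => ‖x - e (s x)‖ :=
    (measurable_id.sub (SimpleFunc.nearestPt e N).measurable).norm
  have i1 := hγ.integrable_fst (hint hμ)
  have i2 := hγ.integrable_snd (hint hν)
  have i3 : Integrable (fun q : Ed d × Ed d => ‖e (s q.1) - e (s q.2)‖) γ := by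
    have hm : Measurable fun q : Ed d × Ed d => (s q.1, s q.2) :=
      (hs.comp measurable_fst).prodMk (hs.comp measurable_snd)
    have := Measure.isProbabilityMeasure_map (μ := γ) hm.aemeasurable
    exact (Integrable.of_finite (f := fun z : Fin (N + 1) × Fin (N + 1) => ‖e z.1 - e z.2‖)
      (μ := γ.map fun q => (s q.1, s q.2))).comp_measurable hm
  have hle : ∫ q, ‖q.1 - q.2‖ ∂γ ≤ ∫ q : Ed d × Ed d,
      (‖q.1 - e (s q.1)‖ + ‖e (s q.1) - e (s q.2)‖ + ‖q.2 - e (s q.2)‖) ∂γ := by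
    refine integral_mono (hγ.integrable_norm_sub hμ hν) ((i1.add i3).add i2) fun q => ?_
    have h1 := norm_sub_le_norm_sub_add_norm_sub q.1 (e (s q.1)) q.2
    have h2 := norm_sub_le_norm_sub_add_norm_sub (e (s q.1)) (e (s q.2)) q.2
    rw [norm_sub_rev (e (s q.2))] at h2
    change ‖q.1 - q.2‖ ≤ ‖q.1 - e (s q.1)‖ + ‖e (s q.1) - e (s q.2)‖ + ‖q.2 - e (s q.2)‖
    linarith
  have i13 : Integrable (fun q : Ed d × Ed d =>
      ‖q.1 - e (s q.1)‖ + ‖e (s q.1) - e (s q.2)‖) γ := i1.add i3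
  rw [integral_add i13 i2, integral_add i1 i3, hγ.integral_fst hmeas,
    hγ.integral_snd hmeas, hγc] at hle
  simp only [hes] at hle
  linarith

lemma isLUB_testFun_wdist {d : ℕ} {μ ν : Measure (Ed d)} (hμ : MemP d 1 μ) (hν : MemP d 1 ν) :
    IsLUB (range fun k => ∫ x, testFun d k x ∂μ - ∫ x, testFun d k x ∂ν) (wdist d 1 μ ν) := by
  refine ⟨?_, fun w hw => wdist_le_of_forall_testFun hμ hν fun k => hw ⟨k, rfl⟩⟩
  rintro _ ⟨k, rfl⟩
  exact integral_sub_integral_le_wdist hμ hν (lipschitzWith_testFun d k)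

lemma integral_gaussDensity (d : ℕ) {δ : ℝ} (hδ : 0 < δ) : ∫ x, gaussDensity d δ x = 1 := by
  have h := GaussianFourier.integral_rexp_neg_mul_sq_norm (V := Ed d)
    (show 0 < 1 / (2 * δ) by positivity)
  have e : ∀ x : Ed d, gaussDensity d δ x
      = (2 * Real.pi * δ) ^ (-(d : ℝ) / 2) * Real.exp (-(1 / (2 * δ)) * ‖x‖ ^ 2) := by
    intro x
    rw [gaussDensity]
    congr 2
    ring
  simp_rw [e]
  rw [integral_const_mul, h, finrank_euclideanSpace_fin, neg_div, Real.rpow_neg (by positivity),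
    show Real.pi / (1 / (2 * δ)) = 2 * Real.pi * δ by field_simp]
  exact inv_mul_cancel₀ (by positivity)

lemma gaussDensity_nonneg (d : ℕ) {δ : ℝ} (hδ : 0 < δ) (x : Ed d) : 0 ≤ gaussDensity d δ x := by
  rw [gaussDensity]
  positivity

lemma measurable_gaussDensity (d : ℕ) (δ : ℝ) : Measurable (gaussDensity d δ) := by
  unfold gaussDensity
  fun_prop

lemma isProbabilityMeasure_gaussMeasure (d : ℕ) {δ : ℝ} (hδ : 0 < δ) :
    IsProbabilityMeasure (gaussMeasure d δ) := by
  refine ⟨?_⟩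
  have hint : Integrable (gaussDensity d δ) :=
    .of_integral_ne_zero (by rw [integral_gaussDensity d hδ]; exact one_ne_zero)
  rw [gaussMeasure, withDensity_apply _ MeasurableSet.univ, Measure.restrict_univ,
    ← ofReal_integral_eq_lintegral_ofReal hint (ae_of_all _ (gaussDensity_nonneg d hδ)),
    integral_gaussDensity d hδ, ENNReal.ofReal_one]

lemma memP_one_gaussMeasure (d : ℕ) {δ : ℝ} (hδ : 0 < δ) : MemP d 1 (gaussMeasure d δ) := by
  refine ⟨isProbabilityMeasure_gaussMeasure d hδ, ?_⟩
  simp only [Real.rpow_one]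
  rw [gaussMeasure, integrable_withDensity_iff_integrable_smul'
    (measurable_gaussDensity d δ).ennreal_ofReal (ae_of_all _ fun _ => ENNReal.ofReal_lt_top)]
  have hc : 0 < 1 / (4 * δ) := by positivity
  set c := 1 / (4 * δ) with hcδ
  have hint : Integrable fun x : Ed d => Real.exp (-c * ‖x‖ ^ 2) :=
    .of_integral_ne_zero (by
      rw [GaussianFourier.integral_rexp_neg_mul_sq_norm hc]; positivity)
  refine (hint.const_mul ((2 * Real.pi * δ) ^ (-(d : ℝ) / 2) * (1 + 1 / c))).mono'
    ((measurable_gaussDensity d δ).ennreal_ofReal.ennreal_toReal.smul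
      measurable_norm).aestronglyMeasurable (ae_of_all _ fun x => ?_)
  rw [ENNReal.toReal_ofReal (gaussDensity_nonneg d hδ x), smul_eq_mul, Real.norm_of_nonneg
    (mul_nonneg (gaussDensity_nonneg d hδ x) (norm_nonneg x)), gaussDensity,
    show -‖x‖ ^ 2 / (2 * δ) = -c * ‖x‖ ^ 2 + -(c * ‖x‖ ^ 2) by rw [hcδ]; field_simp; ring,
    Real.exp_add]
  have h1 : ‖x‖ ≤ (1 + 1 / c) * Real.exp (c * ‖x‖ ^ 2) := by
    have h2 : (1 + 1 / c) * (c * ‖x‖ ^ 2 + 1) ≤ (1 + 1 / c) * Real.exp (c * ‖x‖ ^ 2) :=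
      mul_le_mul_of_nonneg_left (Real.add_one_le_exp _) (by positivity)
    have h3 : (1 + 1 / c) * (c * ‖x‖ ^ 2 + 1) = c * ‖x‖ ^ 2 + 1 + ‖x‖ ^ 2 + 1 / c := by
      field_simp
      ring
    have h4 : 0 < 1 / c := by positivity
    nlinarith [sq_nonneg (‖x‖ - 1), sq_nonneg ‖x‖, mul_nonneg hc.le (sq_nonneg ‖x‖)]
  have h2 : Real.exp (-(c * ‖x‖ ^ 2)) * ‖x‖ ≤ 1 + 1 / c := by
    rw [Real.exp_neg, inv_mul_le_iff₀ (Real.exp_pos _)]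
    linarith
  calc _ = (2 * Real.pi * δ) ^ (-(d : ℝ) / 2) * Real.exp (-c * ‖x‖ ^ 2)
        * (Real.exp (-(c * ‖x‖ ^ 2)) * ‖x‖) := by ring
    _ ≤ (2 * Real.pi * δ) ^ (-(d : ℝ) / 2) * Real.exp (-c * ‖x‖ ^ 2) * (1 + 1 / c) :=
        mul_le_mul_of_nonneg_left h2 (by positivity)
    _ = _ := by ring

lemma MemP.heatFlow {d : ℕ} {μ : Measure (Ed d)} (hμ : MemP d 1 μ) (t s : ℝ) :
    MemP d 1 (heatFlow d t s μ) := by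
  rw [_root_.heatFlow]
  split_ifs with h
  · exact hμ
  have hG := memP_one_gaussMeasure d (sub_pos.2 (not_le.1 h))
  have := hμ.1
  have := hG.1
  have hγ := isCoupling_prod μ (gaussMeasure d (s - t))
  refine ⟨Measure.isProbabilityMeasure_map (by fun_prop), ?_⟩
  simp only [Real.rpow_one]
  rw [integrable_map_measure (by fun_prop) (by fun_prop)]
  refine ((hγ.integrable_fst hμ.integrable_norm).add
    (hγ.integrable_snd hG.integrable_norm)).mono' (by fun_prop) (ae_of_all _ fun q => ?_)
  simpa using norm_add_le q.1 q.2

lemma exists_integral_heatFlow_le (d : ℕ) (t s : ℝ) : ∃ C : ℝ, ∀ μ, MemP d 1 μ →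
    ∀ φ : Ed d → ℝ, LipschitzWith 1 φ → ∫ x, φ x ∂(heatFlow d t s μ) ≤ ∫ x, φ x ∂μ + C := by
  refine ⟨if s ≤ t then 0 else ∫ y, ‖y‖ ∂(gaussMeasure d (s - t)), fun μ hμ φ hφ => ?_⟩
  have hint := hφ.integrable_of_memP (hμ.heatFlow t s)
  rw [heatFlow] at hint ⊢
  split_ifs at hint ⊢ with h
  · simp
  have hG := memP_one_gaussMeasure d (sub_pos.2 (not_le.1 h))
  have := hμ.1
  have := hG.1
  have hγ := isCoupling_prod μ (gaussMeasure d (s - t))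
  rw [integral_map (by fun_prop) hφ.continuous.aestronglyMeasurable,
    ← hγ.integral_fst hφ.continuous.measurable, ← hγ.integral_snd measurable_norm,
    ← integral_add (hγ.integrable_fst (hφ.integrable_of_memP hμ))
      (hγ.integrable_snd hG.integrable_norm)]
  refine integral_mono (hint.comp_measurable (by fun_prop))
    ((hγ.integrable_fst (hφ.integrable_of_memP hμ)).add (hγ.integrable_snd hG.integrable_norm))
    fun q => ?_
  have h1 := hφ.dist_le_mul (q.1 + q.2) q.1
  rw [dist_eq_norm, dist_eq_norm, add_sub_cancel_left] at h1
  have h2 := (le_abs_self _).trans h1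
  simp only [NNReal.coe_one, one_mul, tsub_le_iff_right] at h2
  linarith

lemma MemP.of_two {d : ℕ} {μ : Measure (Ed d)} (hμ : MemP d 2 μ) : MemP d 1 μ := by
  have := hμ.1
  refine ⟨hμ.1, ((integrable_const 1).add hμ.2).mono'
    (by simp only [Real.rpow_one]; fun_prop) (ae_of_all _ fun x => ?_)⟩
  have : ‖x‖ ≤ 1 + ‖x‖ ^ 2 := by nlinarith [sq_nonneg (‖x‖ - 1), sq_nonneg ‖x‖]
  simpa using this

lemma measurable_integral_of_measurable {d : ℕ} {Ω : Type*} [MeasurableSpace Ω]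
    {κ : Ω → Measure (Ed d)} (hκ : Measurable κ) {f : Ed d → ℝ} (hf : Continuous f) :
    Measurable fun ω => ∫ x, f x ∂κ ω :=
  (hf.stronglyMeasurable.integral_kernel
    (κ := (⟨κ, hκ⟩ : ProbabilityTheory.Kernel Ω (Ed d)))).measurable

/-- `x ↦ min n ‖x‖` as a bounded continuous function. -/
def clampNorm (d n : ℕ) : Ed d →ᵇ ℝ :=
  BoundedContinuousFunction.ofNormedAddCommGroup (fun x => clamp n ‖x‖)
    ((lipschitzWith_clamp n).continuous.comp continuous_norm) n fun _ => abs_clamp_le _ _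

lemma lipschitzWith_clampNorm (d n : ℕ) : LipschitzWith 1 (clampNorm d n) := by
  have := (lipschitzWith_clamp n).comp (lipschitzWith_one_norm (E := Ed d))
  rwa [one_mul] at this

lemma clampNorm_nonneg {d : ℕ} (n : ℕ) (x : Ed d) : 0 ≤ clampNorm d n x :=
  le_max_of_le_right (le_min n.cast_nonneg (norm_nonneg x))

lemma clampNorm_le {d : ℕ} (n : ℕ) (x : Ed d) : clampNorm d n x ≤ ‖x‖ := by
  have := (le_abs_self _).trans (abs_clamp_le_abs n ‖x‖)
  rwa [abs_norm] at this

section RandomMeasure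

variable {d : ℕ} {Ω : Type*} [MeasurableSpace Ω] {P : Measure Ω}
  {κ η : Ω → Measure (Ed d)}

lemma integrable_integral_boundedContinuous [IsProbabilityMeasure P] (hκ : Measurable κ)
    (hκ₁ : ∀ ω, MemP d 1 (κ ω)) (φ : Ed d →ᵇ ℝ) : Integrable (fun ω => ∫ x, φ x ∂κ ω) P := by
  refine (integrable_const ‖φ‖).mono'
    (measurable_integral_of_measurable hκ φ.continuous).aestronglyMeasurable
    (ae_of_all _ fun ω => ?_)
  have := (hκ₁ ω).1
  exact φ.norm_integral_le_norm _

lemma integrable_integral_norm [IsProbabilityMeasure P] (hκ : Measurable κ)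
    (hκ₁ : ∀ ω, MemP d 1 (κ ω)) {C : ℝ}
    (hC : ∀ n, ∫ ω, ∫ x, clampNorm d n x ∂κ ω ∂P ≤ C) :
    Integrable (fun ω => ∫ x, ‖x‖ ∂κ ω) P := by
  refine ⟨(measurable_integral_of_measurable hκ continuous_norm).aestronglyMeasurable, ?_⟩
  have hlim : ∀ ω, Tendsto (fun n => ‖∫ x, clampNorm d n x ∂κ ω‖ₑ) atTop
      (𝓝 ‖∫ x, ‖x‖ ∂κ ω‖ₑ) := fun ω =>
    (tendsto_integral_clamp (hκ₁ ω).integrable_norm).enorm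
  have hn : ∀ n, ∫⁻ ω, ‖∫ x, clampNorm d n x ∂κ ω‖ₑ ∂P ≤ ENNReal.ofReal C := by
    intro n
    have h0 : ∀ ω, 0 ≤ ∫ x, clampNorm d n x ∂κ ω := fun ω =>
      integral_nonneg fun x => clampNorm_nonneg n x
    simp_rw [fun ω => Real.enorm_of_nonneg (h0 ω)]
    rw [← ofReal_integral_eq_lintegral_ofReal
      (integrable_integral_boundedContinuous hκ hκ₁ _) (ae_of_all _ h0)]
    exact ENNReal.ofReal_le_ofReal (hC n)
  refine lt_of_le_of_lt ?_ (ENNReal.ofReal_lt_top (r := C))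
  calc ∫⁻ ω, ‖∫ x, ‖x‖ ∂κ ω‖ₑ ∂P
      = ∫⁻ ω, liminf (fun n => ‖∫ x, clampNorm d n x ∂κ ω‖ₑ) atTop ∂P :=
        lintegral_congr fun ω => (hlim ω).liminf_eq.symm
    _ ≤ liminf (fun n => ∫⁻ ω, ‖∫ x, clampNorm d n x ∂κ ω‖ₑ ∂P) atTop :=
        lintegral_liminf_le fun n =>
          (measurable_integral_of_measurable hκ (clampNorm d n).continuous).enorm
    _ ≤ ENNReal.ofReal C := (liminf_le_liminf (Eventually.of_forall hn)).trans_eq (liminf_const _)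

lemma measurable_wdist (hκ : Measurable κ) (hη : Measurable η) (hκ₁ : ∀ ω, MemP d 1 (κ ω))
    (hη₁ : ∀ ω, MemP d 1 (η ω)) : Measurable fun ω => wdist d 1 (κ ω) (η ω) := by
  have h : ∀ ω, wdist d 1 (κ ω) (η ω)
      = ⨆ k, (∫ x, testFun d k x ∂κ ω - ∫ x, testFun d k x ∂η ω) := fun ω =>
    (isLUB_testFun_wdist (hκ₁ ω) (hη₁ ω)).ciSup_eq.symm
  simp_rw [h]
  exact Measurable.iSup fun k =>
    (measurable_integral_of_measurable hκ (testFun d k).continuous).sub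
      (measurable_integral_of_measurable hη (testFun d k).continuous)

lemma integrable_wdist (hκ : Measurable κ) (hη : Measurable η) (hκ₁ : ∀ ω, MemP d 1 (κ ω))
    (hη₁ : ∀ ω, MemP d 1 (η ω)) (hκi : Integrable (fun ω => ∫ x, ‖x‖ ∂κ ω) P)
    (hηi : Integrable (fun ω => ∫ x, ‖x‖ ∂η ω) P) :
    Integrable (fun ω => wdist d 1 (κ ω) (η ω)) P := by
  refine (hκi.add hηi).mono' (measurable_wdist hκ hη hκ₁ hη₁).aestronglyMeasurable
    (ae_of_all _ fun ω => ?_)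
  rw [Real.norm_of_nonneg (wdist_one_nonneg _ _)]
  exact wdist_le_integral_norm_add (hκ₁ ω) (hη₁ ω)

end RandomMeasure

lemma genFiltration_le {Ω : Type} [mΩ : MeasurableSpace Ω] {d : ℕ} {M : ℝ → Ω → Measure (Ed d)}
    (hM : ∀ s, Measurable (M s)) (t s : ℝ) : genFiltration d M t s ≤ mΩ :=
  (iInf₂_le (s + 1) (lt_add_one s)).trans (iSup₂_le fun r _ => (hM r).comap_le)

lemma measurable_genFiltration {Ω : Type} {d : ℕ} (M : ℝ → Ω → Measure (Ed d)) {t r s : ℝ}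
    (htr : t ≤ r) (hrs : r ≤ s) : Measurable[genFiltration d M t s] (M r) :=
  measurable_iff_comap_le.2 <| le_iInf₂ fun _ hu =>
    le_iSup₂_of_le r ⟨htr, hrs.trans (le_of_lt hu)⟩ le_rfl

/-- Let `(t,m) ∈ [0,T] × 𝒫₂` and `M ∈ 𝓜(t,m)`. For all
`t ≤ t₁ ≤ t₂ ≤ t₃ ≤ T`, almost surely
`d₁(p^{t₂,M_{t₂}}_{t₃}, M_{t₁}) ≤ E[ d₁(M_{t₃}, M_{t₁}) | 𝓕^M_{t₂} ]`. -/
theorem mvp_jensen_inequality (d : ℕ) (T t : ℝ) (ht : 0 ≤ t) (htT : t ≤ T)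
    (m : Measure (Ed d)) (hm : MemP d 2 m) (X : MVP d T t m)
    (t₁ t₂ t₃ : ℝ) (h1 : t ≤ t₁) (h2 : t₁ ≤ t₂) (h3 : t₂ ≤ t₃) (h4 : t₃ ≤ T) :
    ∀ᵐ ω ∂X.P,
      wdist d 1 (heatFlow d t₂ t₃ (X.M t₂ ω)) (X.M t₁ ω)
        ≤ (X.P[(fun ω' => wdist d 1 (X.M t₃ ω') (X.M t₁ ω')) |
            genFiltration d X.M t t₂]) ω := by
  obtain ⟨Ω, mΩ, P, probP, M, meas, inP1, -, init, cond⟩ := X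
  change ∀ᵐ ω ∂P, wdist d 1 (heatFlow d t₂ t₃ (M t₂ ω)) (M t₁ ω)
    ≤ (P[(fun ω' => wdist d 1 (M t₃ ω') (M t₁ ω')) | genFiltration d M t t₂]) ω
  have hF := genFiltration_le meas t
  have hmoment : ∀ s ∈ Icc t T, Integrable (fun ω => ∫ x, ‖x‖ ∂M s ω) P := by
    intro s hs
    obtain ⟨C, hC⟩ := exists_integral_heatFlow_le d t s
    have htI : t ∈ Icc t T := ⟨le_rfl, htT⟩
    refine integrable_integral_norm (C := ∫ x, ‖x‖ ∂m + C) (meas s) (inP1 s hs) fun n => ?_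
    have hm₁ := hm.of_two
    have hi := integrable_integral_boundedContinuous (P := P) (meas t) (inP1 t htI) (clampNorm d n)
    have hc := cond t s le_rfl hs.1 hs.2 (clampNorm d n)
    rw [← integral_condExp (hF t), integral_congr_ae hc]
    calc ∫ ω, ∫ x, clampNorm d n x ∂heatFlow d t s (M t ω) ∂P
        ≤ ∫ ω, (∫ x, clampNorm d n x ∂M t ω + C) ∂P :=
          integral_mono (integrable_condExp.congr hc) (hi.add (integrable_const C)) fun ω =>
            hC _ (inP1 t htI ω) _ (lipschitzWith_clampNorm d n)
      _ = ∫ x, clampNorm d n x ∂m + C := by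
          rw [integral_add hi (integrable_const C), init]; simp
      _ ≤ ∫ x, ‖x‖ ∂m + C := by
          refine add_le_add (integral_mono ((lipschitzWith_clampNorm d n).integrable_of_memP hm₁)
            hm₁.integrable_norm (clampNorm_le n)) le_rfl
  have ht₁ : t₁ ∈ Icc t T := ⟨h1, by linarith⟩
  have ht₂ : t₂ ∈ Icc t T := ⟨by linarith, by linarith⟩
  have ht₃ : t₃ ∈ Icc t T := ⟨by linarith, h4⟩
  have hwi := integrable_wdist (meas t₃) (meas t₁) (inP1 t₃ ht₃) (inP1 t₁ ht₁)
    (hmoment t₃ ht₃) (hmoment t₁ ht₁)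
  have key : ∀ k, ∀ᵐ ω ∂P, ∫ x, testFun d k x ∂(heatFlow d t₂ t₃ (M t₂ ω))
      - ∫ x, testFun d k x ∂(M t₁ ω)
      ≤ (P[(fun ω' => wdist d 1 (M t₃ ω') (M t₁ ω')) | genFiltration d M t t₂]) ω := by
    intro k
    have i₃ := integrable_integral_boundedContinuous (P := P) (meas t₃) (inP1 t₃ ht₃) (testFun d k)
    have i₁ := integrable_integral_boundedContinuous (P := P) (meas t₁) (inP1 t₁ ht₁) (testFun d k)
    have hM₁ : P[(fun ω => ∫ x, testFun d k x ∂M t₁ ω) | genFiltration d M t t₂]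
        = fun ω => ∫ x, testFun d k x ∂M t₁ ω :=
      condExp_of_stronglyMeasurable (hF t₂) (@measurable_integral_of_measurable d Ω
        (genFiltration d M t t₂) (M t₁) (measurable_genFiltration M h1 h2) _
        (testFun d k).continuous).stronglyMeasurable i₁
    have hmono := condExp_mono (m := genFiltration d M t t₂) (i₃.sub i₁) hwi
      (ae_of_all _ fun ω => integral_sub_integral_le_wdist (inP1 t₃ ht₃ ω) (inP1 t₁ ht₁ ω)
        (lipschitzWith_testFun d k))
    filter_upwards [hmono, condExp_sub i₃ i₁ (genFiltration d M t t₂),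
      cond t₂ t₃ ht₂.1 h3 h4 (testFun d k)] with ω hω₁ hω₂ hω₃
    rw [hω₂, Pi.sub_apply, hω₃, hM₁] at hω₁
    exact hω₁
  filter_upwards [ae_all_iff.2 key] with ω hω
  exact wdist_le_of_forall_testFun ((inP1 t₂ ht₂ ω).heatFlow t₂ t₃) (inP1 t₁ ht₁ ω) hω

end
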